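/- Let a, b, c, e > 0 and let λ, μ : [0, ∞) → ℝ be continuous with λ̲ ≤ λ(t) ≤ λ̄ and μ̲ ≤ μ(t) ≤ μ̄ for all t ≥ 0, where 0 < λ̲ ≤ λ̄ and 0 < μ̲ ≤ μ̄. Let (x, y) : [0, ∞) → ℝ² be differentiable with x(0) > 0, y(0) ≥ 0, x(t) > 0 and y(t) ≥ 0 for all t, and satisfy x'(t) = x(t)(λ(t) - a x(t) - b y(t)) and y'(t) = y(t)(μ(t) - c x(t) - e y(t)) for all t ≥ 0. If μ̄/λ̲ < e/b (equivalently λ̲ - b μ̄/e > 0), then liminf_{t → ∞} x(t) ≥ (λ̲ - b μ̄/e)/a; in particular the first species persists. -/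

import Mathlib

open Filter

/-- If `f' ≤ -δ` whenever `f ≥ K`, then eventually `f ≤ K`. -/
theorem eventually_le_of_deriv_neg (f f' : ℝ → ℝ) (T K δ : ℝ) (hδ : 0 < δ)
    (hf : ∀ t, T ≤ t → HasDerivWithinAt f (f' t) (Set.Ici T) t)
    (hd : ∀ t, T ≤ t → K ≤ f t → f' t ≤ -δ) :
    ∀ᶠ t in atTop, f t ≤ K := by
  have hr : ∀ t, T ≤ t → HasDerivWithinAt f (f' t) (Set.Ici t) t := fun t ht =>
    (hf t ht).mono (Set.Ici_subset_Ici.2 ht)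
  have hcont : ContinuousOn f (Set.Ici T) := fun t ht => (hf t ht).continuousWithinAt
  have h1 : ∃ s, T ≤ s ∧ f s ≤ K := by
    by_contra! hcon
    have hle : ∀ t, T ≤ t → f t ≤ f T - δ * (t - T) := by
      intro t ht
      refine image_le_of_deriv_right_le_deriv_boundary (a := T) (b := t) (f := f) (f' := f')
        (B := fun s => f T - δ * (s - T)) (B' := fun _ => -δ)
        (hcont.mono Set.Icc_subset_Ici_self) (fun s hs => hr s hs.1) (by simp)
        (by fun_prop) ?_ (fun s hs => hd s hs.1 (hcon s hs.1).le) ⟨ht, le_rfl⟩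
      intro s _
      have h := (((hasDerivAt_id s).sub_const T).const_mul δ).const_sub (f T)
      simpa using h.hasDerivWithinAt
    have hT := hcon T le_rfl
    have h2 : T ≤ T + (f T - K) / δ := by
      have : 0 ≤ (f T - K) / δ := div_nonneg (by linarith) hδ.le
      linarith
    have h3 := hle _ h2
    have h4 := hcon _ h2
    have h5 : δ * (T + (f T - K) / δ - T) = f T - K := by field_simp; ring
    rw [h5] at h3
    linarith
  obtain ⟨s, hs, hfs⟩ := h1
  filter_upwards [eventually_ge_atTop s] with t ht
  refine image_le_of_deriv_right_lt_deriv_boundary (a := s) (b := t) (f := f) (f' := f')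
    (B := fun _ => K) (B' := fun _ => 0)
    (hcont.mono fun u hu => hs.trans hu.1) (fun u hu => hr u (hs.trans hu.1)) hfs
    (fun u => hasDerivAt_const u K) ?_ ⟨ht, le_rfl⟩
  intro u hu huK
  have := hd u (hs.trans hu.1) huK.ge
  linarith


/-- Persistence of the first species in the competitive Lotka–Volterra system: if
`λ̲ - b μ̄/e > 0` then `liminf x ≥ (λ̲ - b μ̄/e)/a`. -/
theorem lotka_volterra_first_species_persists (a b c e lamLow lamUp muLow muUp : ℝ)
    (ha : 0 < a) (hb : 0 < b) (hc : 0 < c) (he : 0 < e)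
    (hlamLow : 0 < lamLow) (hlam_le : lamLow ≤ lamUp)
    (hmuLow : 0 < muLow) (hmu_le : muLow ≤ muUp)
    (lam mu : ℝ → ℝ)
    (hlam : ContinuousOn lam (Set.Ici (0 : ℝ))) (hmu : ContinuousOn mu (Set.Ici (0 : ℝ)))
    (hlam_mem : ∀ t ∈ Set.Ici (0 : ℝ), lam t ∈ Set.Icc lamLow lamUp)
    (hmu_mem : ∀ t ∈ Set.Ici (0 : ℝ), mu t ∈ Set.Icc muLow muUp)
    (x y : ℝ → ℝ) (hx0 : 0 < x 0) (hy0 : 0 ≤ y 0)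
    (hxpos : ∀ t ∈ Set.Ici (0 : ℝ), 0 < x t)
    (hynonneg : ∀ t ∈ Set.Ici (0 : ℝ), 0 ≤ y t)
    (hx : ∀ t ∈ Set.Ici (0 : ℝ),
      HasDerivWithinAt x (x t * (lam t - a * x t - b * y t)) (Set.Ici (0 : ℝ)) t)
    (hy : ∀ t ∈ Set.Ici (0 : ℝ),
      HasDerivWithinAt y (y t * (mu t - c * x t - e * y t)) (Set.Ici (0 : ℝ)) t)
    (hpersist : muUp / lamLow < e / b) :
    (lamLow - b * muUp / e) / a ≤ liminf x atTop := by
  -- the first species is bounded above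
  have hub : ∀ᶠ t in atTop, x t ≤ lamUp / a + 1 := by
    refine eventually_le_of_deriv_neg x _ 0 _ (1 * a) (by positivity) hx ?_
    intro t ht hK
    have h1 := (hlam_mem t ht).2
    have h2 := mul_nonneg hb.le (hynonneg t ht)
    have h3 : lamUp + a ≤ a * x t := by
      have := mul_le_mul_of_nonneg_left hK ha.le
      have h4 : a * (lamUp / a + 1) = lamUp + a := by field_simp
      linarith
    have h5 : 1 ≤ x t := by
      have : 0 ≤ lamUp / a := div_nonneg (by linarith) ha.le
      linarith
    nlinarith
  have hub' : ∀ ε > 0, ∀ᶠ t in atTop, y t ≤ muUp / e + ε := by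
    intro ε hε
    refine eventually_le_of_deriv_neg y _ 0 _ (ε * (e * ε)) (by positivity) hy ?_
    intro t ht hK
    have h1 := (hmu_mem t ht).2
    have h2 := mul_nonneg hc.le (hxpos t ht).le
    have h3 : muUp + e * ε ≤ e * y t := by
      have := mul_le_mul_of_nonneg_left hK he.le
      have h4 : e * (muUp / e + ε) = muUp + e * ε := by field_simp
      linarith
    have h5 : ε ≤ y t := by
      have : 0 ≤ muUp / e := div_nonneg (by linarith) he.le
      linarith
    have h6 : 0 < e * ε := by positivity
    nlinarith
  have hL : 0 < (lamLow - b * muUp / e) / a := by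
    apply div_pos _ ha
    rw [div_lt_div_iff₀ hlamLow hb] at hpersist
    rw [sub_pos, div_lt_iff₀ he]
    linarith
  by_contra! hcon
  obtain ⟨K, hK1, hK2⟩ := exists_between (max_lt hcon hL)
  have hK0 : 0 < K := (le_max_right _ _).trans_lt hK1
  have hKl : liminf x atTop < K := (le_max_left _ _).trans_lt hK1
  have hη : 0 < lamLow - b * muUp / e - a * K := by
    rw [lt_div_iff₀ ha] at hK2
    linarith
  set η := lamLow - b * muUp / e - a * K with hηdef
  obtain ⟨T, hT⟩ := eventually_atTop.1
    ((hub' (η / (2 * b)) (by positivity)).and (eventually_ge_atTop 0))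
  have hT0 : 0 ≤ T := (hT T le_rfl).2
  have hlow : ∀ᶠ t in atTop, -Real.log (x t) ≤ -Real.log K := by
    refine eventually_le_of_deriv_neg (fun t => -Real.log (x t))
      (fun t => -(x t * (lam t - a * x t - b * y t) / x t)) T _ (η / 2) (by positivity) ?_ ?_
    · intro t ht
      have ht0 : 0 ≤ t := hT0.trans ht
      exact (((hx t ht0).mono (Set.Ici_subset_Ici.2 hT0)).log (hxpos t ht0).ne').neg
    · intro t ht hKt
      have ht0 : 0 ≤ t := hT0.trans ht
      have hxt := hxpos t ht0
      have h1 : x t ≤ K := (Real.log_le_log_iff hxt hK0).1 (by simpa using hKt)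
      have h2 := (hlam_mem t ht0).1
      have h3 := mul_le_mul_of_nonneg_left (hT t ht).1 hb.le
      have h4 : b * (muUp / e + η / (2 * b)) = b * muUp / e + η / 2 := by field_simp
      have h5 := mul_le_mul_of_nonneg_left h1 ha.le
      change -(x t * (lam t - a * x t - b * y t) / x t) ≤ -(η / 2)
      rw [mul_div_cancel_left₀ _ hxt.ne']
      linarith
  have hlow' : ∀ᶠ t in atTop, K ≤ x t := by
    filter_upwards [hlow, eventually_ge_atTop 0] with t h1 h2
    exact (Real.log_le_log_iff hK0 (hxpos t h2)).1 (by linarith)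
  have hbd : IsBoundedUnder (· ≤ ·) atTop x := ⟨_, eventually_map.2 hub⟩
  have := le_liminf_of_le hbd.isCoboundedUnder_ge hlow'
  linarith
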